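/- Let K be a field and let f ∈ K((x_n)) over the field L = K⟨⟨x_1,...,x_{n-1}⟩⟩ (so f is a Laurent series in x_n with coefficients in L) that is algebraic over L(x_n) of degree d and height at most h. Then the x_n-adic valuation ν of f satisfies |ν(f)| ≤ h, and x_n^{-ν(f)}·f is algebraic of degree d and height at most h(d+1). -/

import Mathlib

/-- The canonical ring homomorphism `L[x] →+* L((x))`. -/
noncomputable def polyToLaurent (L : Type*) [Field L] :
    Polynomial L →+* LaurentSeries L :=
  (HahnSeries.ofPowerSeries ℤ L).comp Polynomial.coeToPowerSeries.ringHom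

theorem key_div {L : Type*} [Field L] (d m e : ℕ) (a : ℕ → ℕ) (p : ℕ → Polynomial L)
    (u : PowerSeries L) (hu : IsUnit u) (he : e ≤ d) (hpe : p e ≠ 0) (hae : a e = 0)
    (ha : ∀ i ≤ d, i ≠ e → m ≤ a i)
    (hsum : ∑ i ∈ Finset.range (d + 1),
      (((Polynomial.X ^ a i * p i : Polynomial L)) : PowerSeries L) * u ^ i = 0) :
    m ≤ (p e).natDegree := by
  have hmem : e ∈ Finset.range (d + 1) := Finset.mem_range.2 (by omega)
  rw [← Finset.add_sum_erase _ _ hmem] at hsum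
  have h1 : (PowerSeries.X : PowerSeries L) ^ m ∣ ∑ i ∈ (Finset.range (d + 1)).erase e,
      (((Polynomial.X ^ a i * p i : Polynomial L)) : PowerSeries L) * u ^ i := by
    refine Finset.dvd_sum fun i hi => ?_
    rw [Finset.mem_erase, Finset.mem_range] at hi
    rw [Polynomial.coe_mul, Polynomial.coe_pow, Polynomial.coe_X, mul_assoc]
    exact Dvd.dvd.mul_right (pow_dvd_pow _ (ha i (by omega) hi.1)) _
  have h2 : (PowerSeries.X : PowerSeries L) ^ m ∣ (p e : PowerSeries L) := by
    rw [eq_neg_of_add_eq_zero_right hsum, dvd_neg, (hu.pow e).dvd_mul_right, hae,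
      pow_zero, one_mul] at h1
    exact h1
  rw [PowerSeries.X_pow_dvd_iff] at h2
  by_contra hlt
  push Not at hlt
  have := h2 _ hlt
  rw [Polynomial.coeff_coe] at this
  exact hpe (Polynomial.leadingCoeff_eq_zero.1 this)

theorem polyToLaurent_X_pow {L : Type*} [Field L] (n : ℕ) :
    polyToLaurent L (Polynomial.X ^ n) = HahnSeries.single (n : ℤ) (1 : L) := by
  simp [polyToLaurent]

theorem core {L : Type*} [Field L]
    (d h : ℕ) (f : LaurentSeries L) (hf : f ≠ 0)
    (P : Polynomial (Polynomial L))
    (hPdeg : P.natDegree = d) (hP : P ≠ 0)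
    (hPh : ∀ i, (P.coeff i).natDegree ≤ h)
    (hann : Polynomial.eval₂ (polyToLaurent L) f P = 0)
    (e c : ℕ) (a : ℕ → ℕ) (he : e ≤ d) (hpe : P.coeff e ≠ 0) (hae : a e = 0)
    (ha : ∀ i ≤ d, i ≠ e → f.order.natAbs ≤ a i)
    (ha2 : ∀ i ≤ d, a i ≤ f.order.natAbs * d)
    (hac : ∀ i ≤ d, (a i : ℤ) = i * f.order + c) :
    f.order.natAbs ≤ h ∧
      ∃ Q : Polynomial (Polynomial L), Q ≠ 0 ∧ Q.natDegree = d ∧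
        (∀ i, (Q.coeff i).natDegree ≤ h * (d + 1)) ∧
        Polynomial.eval₂ (polyToLaurent L)
          (HahnSeries.single (-f.order) (1 : L) * f) Q = 0 := by
  set g : LaurentSeries L := HahnSeries.single (-f.order) (1 : L) * f with hg
  have hfg : f = HahnSeries.single f.order (1 : L) * g := by
    rw [hg, ← mul_assoc, HahnSeries.single_mul_single]
    simp
  have hgu : g = HahnSeries.ofPowerSeries ℤ L f.powerSeriesPart := by
    rw [LaurentSeries.ofPowerSeries_powerSeriesPart]
  have hu : IsUnit f.powerSeriesPart := by
    rw [PowerSeries.isUnit_iff_constantCoeff, isUnit_iff_ne_zero,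
      ← PowerSeries.coeff_zero_eq_constantCoeff_apply, LaurentSeries.powerSeriesPart_coeff]
    simpa [HahnSeries.coeff_order_eq_zero] using hf
  have hsum : ∑ i ∈ Finset.range (d + 1),
      polyToLaurent L (Polynomial.X ^ a i * P.coeff i) * g ^ i = 0 := by
    rw [Polynomial.eval₂_eq_sum_range, hPdeg] at hann
    have := congrArg (HahnSeries.single (c : ℤ) (1 : L) * ·) hann
    simp only [mul_zero, Finset.mul_sum] at this
    rw [← this]
    refine Finset.sum_congr rfl fun i hi => ?_
    have hi' : i ≤ d := by simpa [Nat.lt_succ_iff] using hi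
    have hfi : f ^ i = HahnSeries.single ((i : ℤ) * f.order) (1 : L) * g ^ i := by
      have h1 : f ^ i = (HahnSeries.single f.order (1 : L) * g) ^ i := congrArg (· ^ i) hfg
      rw [h1, mul_pow (HahnSeries.single f.order (1 : L)) g i, HahnSeries.single_pow, one_pow,
        nsmul_eq_mul]
    rw [map_mul, polyToLaurent_X_pow, hac i hi', hfi]
    have : (HahnSeries.single ((i : ℤ) * f.order + c) (1 : L)) =
      HahnSeries.single ((i : ℤ) * f.order) (1 : L) * HahnSeries.single (c : ℤ) (1 : L) := by
      rw [HahnSeries.single_mul_single, one_mul]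
    rw [this]
    ring
  have hm : f.order.natAbs ≤ h := by
    refine le_trans (key_div d _ e a P.coeff _ hu he hpe hae ha ?_) (hPh e)
    apply HahnSeries.ofPowerSeries_injective (Γ := ℤ) (R := L)
    rw [map_zero, ← hsum, map_sum]
    refine Finset.sum_congr rfl fun i _ => ?_
    rw [map_mul, map_pow, ← hgu]
    rfl
  refine ⟨hm, ∑ i ∈ Finset.range (d + 1),
    Polynomial.monomial i (Polynomial.X ^ a i * P.coeff i), ?_⟩
  have hco : ∀ j, (∑ i ∈ Finset.range (d + 1),
    Polynomial.monomial i (Polynomial.X ^ a i * P.coeff i)).coeff j =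
      if j ≤ d then Polynomial.X ^ a j * P.coeff j else 0 := by
    intro j
    simp [Polynomial.finsetSum_coeff, Polynomial.coeff_monomial]
  have hd : (∑ i ∈ Finset.range (d + 1),
    Polynomial.monomial i (Polynomial.X ^ a i * P.coeff i)).coeff d ≠ 0 := by
    rw [hco, if_pos le_rfl]
    refine mul_ne_zero (pow_ne_zero _ Polynomial.X_ne_zero) ?_
    rw [← hPdeg]
    exact Polynomial.leadingCoeff_ne_zero.2 hP
  refine ⟨fun h0 => hd (by rw [h0]; simp), ?_, ?_, ?_⟩
  · refine le_antisymm (Polynomial.natDegree_le_iff_coeff_eq_zero.2 fun j hj => ?_)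
      (Polynomial.le_natDegree_of_ne_zero hd)
    rw [hco, if_neg (by omega)]
  · intro i
    rw [hco]
    split_ifs with hi
    · refine Polynomial.natDegree_mul_le.trans ?_
      rw [Polynomial.natDegree_X_pow]
      have h1 := ha2 i hi
      have h2 := hPh i
      have h3 : f.order.natAbs * d ≤ h * d := Nat.mul_le_mul_right _ hm
      rw [mul_add, mul_one]
      omega
    · simp
  · rw [Polynomial.eval₂_finsetSum, ← hsum]
    simp only [Polynomial.eval₂_monomial]

/-- Lemma 4.9: if `f ∈ L((x_n))` is algebraic over `L(x_n)` of degree `d` and height at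
most `h` (witnessed by an annihilating polynomial of degree exactly `d`, with nonzero
constant and leading coefficients, whose coefficients have degree at most `h`), then
`|ν(f)| ≤ h` and `x_n^{-ν(f)}·f` is algebraic of degree `d` and height at most `h(d+1)`. -/
theorem valuation_bound_and_normalization (L : Type*) [Field L]
    (d h : ℕ) (f : LaurentSeries L) (hf : f ≠ 0)
    (P : Polynomial (Polynomial L))
    (hPdeg : P.natDegree = d)
    (hP0 : P.coeff 0 ≠ 0) (hPlead : P.leadingCoeff ≠ 0)
    (hPh : ∀ i, (P.coeff i).natDegree ≤ h)
    (hann : Polynomial.eval₂ (polyToLaurent L) f P = 0) :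
    f.order.natAbs ≤ h ∧
      ∃ Q : Polynomial (Polynomial L), Q ≠ 0 ∧ Q.natDegree = d ∧
        (∀ i, (Q.coeff i).natDegree ≤ h * (d + 1)) ∧
        Polynomial.eval₂ (polyToLaurent L)
          (HahnSeries.single (-f.order) (1 : L) * f) Q = 0 := by
  have hP : P ≠ 0 := Polynomial.leadingCoeff_ne_zero.1 hPlead
  rcases le_total 0 f.order with hv | hv
  · obtain ⟨m, hm⟩ := Int.eq_ofNat_of_zero_le hv
    have hab : f.order.natAbs = m := by omega
    refine core d h f hf P hPdeg hP hPh hann 0 0 (fun i => m * i) (Nat.zero_le _) hP0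
      (by simp) ?_ ?_ ?_
    · intro i _ h0
      rw [hab]
      exact Nat.le_mul_of_pos_right _ (Nat.pos_of_ne_zero h0)
    · intro i hi
      rw [hab]
      exact Nat.mul_le_mul_left _ hi
    · intro i hi
      rw [hm]
      push_cast
      ring
  · obtain ⟨m, hm⟩ := Int.eq_ofNat_of_zero_le (neg_nonneg.2 hv)
    have hab : f.order.natAbs = m := by omega
    have hm' : f.order = -(m : ℤ) := by omega
    refine core d h f hf P hPdeg hP hPh hann d (m * d) (fun i => m * (d - i)) le_rfl
      (by rw [← hPdeg]; exact hPlead) (by simp) ?_ ?_ ?_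
    · intro i _ h0
      rw [hab]
      exact Nat.le_mul_of_pos_right _ (by omega)
    · intro i hi
      rw [hab]
      exact Nat.mul_le_mul_left _ (by omega)
    · intro i hi
      rw [hm']
      push_cast [Nat.cast_sub hi]
      ring
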